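/- Define the quadratic forms F₀(w₀,w₁,w₂,w₃) = w₀w₁ − w₂² and F₃(w₀,w₁,w₂,w₃) = w₃² − 4w₁w₂ + w₀w₂ on ℂ⁴, and set G₁ = 2F₀ + F₃ and G₂ = −2F₀ + F₃. Then: (1) for all x, y ∈ ℂ with y² = 4x³ − x, both G₁ and G₂ vanish at the point (1, x², x, y); (2) the gradient of G₁ vanishes at a nonzero vector w ∈ ℂ⁴ if and only if w is a scalar multiple of Q₁ = (4,−1,2,0); (3) the gradient of G₂ vanishes at a nonzero vector w ∈ ℂ⁴ if and only if w is a scalar multiple of Q₂ = (4,−1,−2,0). -/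

import Mathlib

/-- The quadratic form `F₀(w) = w₀w₁ - w₂²`. -/
def F0 (w : Fin 4 → ℂ) : ℂ := w 0 * w 1 - (w 2) ^ 2

/-- The quadratic form `F₃(w) = w₃² - 4w₁w₂ + w₀w₂`. -/
def F3 (w : Fin 4 → ℂ) : ℂ := (w 3) ^ 2 - 4 * w 1 * w 2 + w 0 * w 2

/-- `G₁ = 2F₀ + F₃`, a quadric cone through `C₄` with vertex `Q₁`. -/
def G1 (w : Fin 4 → ℂ) : ℂ := 2 * F0 w + F3 w

/-- `G₂ = -2F₀ + F₃`, a quadric cone through `C₄` with vertex `Q₂`. -/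
def G2 (w : Fin 4 → ℂ) : ℂ := -2 * F0 w + F3 w

/-- The differential of `a F₀ + F₃` at `w`. -/
theorem hasFDerivAt_pencil (a : ℂ) (w : Fin 4 → ℂ) :
    HasFDerivAt (fun w => a * F0 w + F3 w)
      ((a * w 1 + w 2) • ContinuousLinearMap.proj (R := ℂ) (φ := fun _ : Fin 4 => ℂ) 0 +
        (a * w 0 - 4 * w 2) • ContinuousLinearMap.proj 1 +
        (-2 * a * w 2 - 4 * w 1 + w 0) • ContinuousLinearMap.proj 2 +
        (2 * w 3) • ContinuousLinearMap.proj 3) w := by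
  have h (i : Fin 4) : HasFDerivAt (fun w : Fin 4 → ℂ => w i)
      (ContinuousLinearMap.proj (R := ℂ) (φ := fun _ : Fin 4 => ℂ) i) w :=
    hasFDerivAt_apply i w
  unfold F0 F3
  refine (((((h 0).mul (h 1)).sub ((h 2).pow 2)).const_mul a).add
    ((((h 3).pow 2).sub (((h 1).const_mul 4).mul (h 2))).add ((h 0).mul (h 2)))).congr_fderiv ?_
  ext v
  simp
  ring

theorem fderiv_pencil_eq_zero_iff (a : ℂ) (w : Fin 4 → ℂ) :
    fderiv ℂ (fun w => a * F0 w + F3 w) w = 0 ↔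
      a * w 1 + w 2 = 0 ∧ a * w 0 - 4 * w 2 = 0 ∧ -2 * a * w 2 - 4 * w 1 + w 0 = 0 ∧
        w 3 = 0 := by
  rw [(hasFDerivAt_pencil a w).fderiv]
  constructor
  · intro h
    have e (i : Fin 4) := DFunLike.congr_fun h (Pi.single i 1)
    exact ⟨by simpa using e 0, by simpa using e 1, by simpa using e 2, by simpa using e 3⟩
  · rintro ⟨h₀, h₁, h₂, h₃⟩
    rw [h₀, h₁, h₂, h₃]
    ext v
    simp

/-- If `a² = 4`, the differential of `a F₀ + F₃` vanishes exactly on the line through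
`(4, -1, a, 0)`. -/
theorem fderiv_pencil_eq_zero_iff_exists_smul {a : ℂ} (ha : a ^ 2 = 4) (w : Fin 4 → ℂ) :
    fderiv ℂ (fun w => a * F0 w + F3 w) w = 0 ↔ ∃ c : ℂ, w = c • ![4, -1, a, 0] := by
  rw [fderiv_pencil_eq_zero_iff]
  constructor
  · rintro ⟨h₀, -, h₂, h₃⟩
    refine ⟨-w 1, ?_⟩
    ext i
    fin_cases i <;> simp
    · linear_combination h₂ + 2 * a * h₀ - 2 * w 1 * ha
    · linear_combination h₀
    · exact h₃
  · rintro ⟨c, rfl⟩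
    simp
    refine ⟨by ring, by ring, by linear_combination (-2 * c) * ha⟩

/-- (1) For `y² = 4x³ - x`, both `G₁` and `G₂` vanish at `(1, x², x, y)`;
(2) the gradient of `G₁` vanishes at a nonzero `w ∈ ℂ⁴` iff `w` is a scalar multiple of
`Q₁ = (4,-1,2,0)`; (3) the gradient of `G₂` vanishes at a nonzero `w` iff `w` is a scalar
multiple of `Q₂ = (4,-1,-2,0)`. -/
theorem stmt_14 :
    (∀ x y : ℂ, y ^ 2 = 4 * x ^ 3 - x →
      G1 ![1, x ^ 2, x, y] = 0 ∧ G2 ![1, x ^ 2, x, y] = 0) ∧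
    (∀ w : Fin 4 → ℂ, w ≠ 0 →
      (fderiv ℂ G1 w = 0 ↔ ∃ c : ℂ, w = c • ![4, -1, 2, 0])) ∧
    (∀ w : Fin 4 → ℂ, w ≠ 0 →
      (fderiv ℂ G2 w = 0 ↔ ∃ c : ℂ, w = c • ![4, -1, -2, 0])) := by
  refine ⟨fun x y h => ⟨?_, ?_⟩, fun w _ => ?_, fun w _ => ?_⟩
  · simp [G1, F0, F3]
    linear_combination h
  · simp [G2, F0, F3]
    linear_combination h
  · exact fderiv_pencil_eq_zero_iff_exists_smul (by norm_num) w
  · exact fderiv_pencil_eq_zero_iff_exists_smul (by norm_num) w
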